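/- The hyperbolic distance on the Poincaré ball is nonnegative and nondegenerate: for every c > 0 and all u, v ∈ ℝⁿ with c‖u‖² < 1 and c‖v‖² < 1, one has d_c(u,v) ≥ 0, and d_c(u,v) = 0 if and only if u = v. -/

import Mathlib

open scoped RealInnerProductSpace

/-- Möbius addition on the Poincaré ball with curvature parameter `c`. -/
noncomputable def mobiusAdd {n : ℕ} (c : ℝ) (u v : EuclideanSpace ℝ (Fin n)) :
    EuclideanSpace ℝ (Fin n) :=
  (1 + 2 * c * ⟪u, v⟫ + c ^ 2 * ‖u‖ ^ 2 * ‖v‖ ^ 2)⁻¹ •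
    ((1 + 2 * c * ⟪u, v⟫ + c * ‖v‖ ^ 2) • u + (1 - c * ‖u‖ ^ 2) • v)

/-- Real inverse hyperbolic tangent. -/
noncomputable def arctanh (x : ℝ) : ℝ := (1 / 2) * Real.log ((1 + x) / (1 - x))

/-- Hyperbolic distance on the Poincaré ball of curvature `-c`. -/
noncomputable def hypDist {n : ℕ} (c : ℝ) (u v : EuclideanSpace ℝ (Fin n)) : ℝ :=
  (2 / Real.sqrt c) * arctanh (Real.sqrt c * ‖mobiusAdd c (-u) v‖)

theorem mobiusAdd_denom_pos {n : ℕ} {c : ℝ} (hc : 0 ≤ c) {u v : EuclideanSpace ℝ (Fin n)}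
    (hu : c * ‖u‖ ^ 2 < 1) (hv : c * ‖v‖ ^ 2 < 1) :
    0 < 1 + 2 * c * ⟪u, v⟫ + c ^ 2 * ‖u‖ ^ 2 * ‖v‖ ^ 2 := by
  have hsum : 0 ≤ c * ‖u + v‖ ^ 2 := by positivity
  rw [norm_add_sq_real] at hsum
  linarith [mul_pos (sub_pos.2 hu) (sub_pos.2 hv)]

theorem norm_mobiusAdd_sq {n : ℕ} {c : ℝ} {u v : EuclideanSpace ℝ (Fin n)}
    (hD : 1 + 2 * c * ⟪u, v⟫ + c ^ 2 * ‖u‖ ^ 2 * ‖v‖ ^ 2 ≠ 0) :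
    ‖mobiusAdd c u v‖ ^ 2 =
      ‖u + v‖ ^ 2 / (1 + 2 * c * ⟪u, v⟫ + c ^ 2 * ‖u‖ ^ 2 * ‖v‖ ^ 2) := by
  rw [mobiusAdd, norm_smul, mul_pow, Real.norm_eq_abs, sq_abs, norm_add_sq_real,
    norm_add_sq_real, norm_smul, norm_smul, mul_pow, mul_pow, Real.norm_eq_abs, Real.norm_eq_abs,
    sq_abs, sq_abs, real_inner_smul_left, real_inner_smul_right]
  field_simp
  ring

/-- The Poincaré ball is closed under Möbius addition. -/
theorem mul_norm_mobiusAdd_sq_lt_one {n : ℕ} {c : ℝ} (hc : 0 ≤ c)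
    {u v : EuclideanSpace ℝ (Fin n)} (hu : c * ‖u‖ ^ 2 < 1) (hv : c * ‖v‖ ^ 2 < 1) :
    c * ‖mobiusAdd c u v‖ ^ 2 < 1 := by
  have hD := mobiusAdd_denom_pos hc hu hv
  rw [norm_mobiusAdd_sq hD.ne', ← mul_div_assoc, div_lt_one hD, norm_add_sq_real]
  linarith [mul_pos (sub_pos.2 hu) (sub_pos.2 hv)]

theorem mobiusAdd_eq_zero_iff {n : ℕ} {c : ℝ} (hc : 0 ≤ c) {u v : EuclideanSpace ℝ (Fin n)}
    (hu : c * ‖u‖ ^ 2 < 1) (hv : c * ‖v‖ ^ 2 < 1) :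
    mobiusAdd c u v = 0 ↔ u + v = 0 := by
  have hD := mobiusAdd_denom_pos hc hu hv
  rw [← norm_eq_zero, ← sq_eq_zero_iff, norm_mobiusAdd_sq hD.ne', div_eq_zero_iff,
    or_iff_left hD.ne', sq_eq_zero_iff, norm_eq_zero]

theorem arctanh_eq_artanh {x : ℝ} (hx : x ∈ Set.Icc (-1) 1) : arctanh x = Real.artanh x :=
  (Real.artanh_eq_half_log hx).symm

theorem hypDist_nonneg_and_eq_zero_iff {n : ℕ} (c : ℝ) (hc : 0 < c)
    (u v : EuclideanSpace ℝ (Fin n))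
    (hu : c * ‖u‖ ^ 2 < 1) (hv : c * ‖v‖ ^ 2 < 1) :
    0 ≤ hypDist c u v ∧ (hypDist c u v = 0 ↔ u = v) := by
  have hu' : c * ‖-u‖ ^ 2 < 1 := by rwa [norm_neg]
  have hs : 0 < Real.sqrt c := Real.sqrt_pos.2 hc
  have h0 : 0 ≤ Real.sqrt c * ‖mobiusAdd c (-u) v‖ := by positivity
  have h1 : Real.sqrt c * ‖mobiusAdd c (-u) v‖ < 1 := by
    rw [← sq_lt_one_iff₀ h0, mul_pow, Real.sq_sqrt hc.le]
    exact mul_norm_mobiusAdd_sq_lt_one hc.le hu' hv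
  rw [hypDist, arctanh_eq_artanh ⟨by linarith, h1.le⟩]
  refine ⟨mul_nonneg (by positivity) (Real.artanh_nonneg h0), ?_⟩
  rw [mul_eq_zero, or_iff_right (by positivity), Real.artanh_eq_zero_iff,
    or_iff_right (by linarith), or_iff_left h1.not_ge, mul_eq_zero, or_iff_right hs.ne',
    norm_eq_zero, mobiusAdd_eq_zero_iff hc.le hu' hv, neg_add_eq_zero]
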